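/- Let D ∈ (0,1) and let Ω be an ordinary fractal string which is Minkowski measurable of dimension D with Minkowski content M. Then its spectral counting function has a monotonic asymptotic second term: N_ν(x) = W(x) − c_D x^D + o(x^D) as x → +∞, where W(x) = (Σ_j l_j)·x is the Weyl term and c_D = 2^{−(1−D)} (1 − D) (−ζ(D)) M; here ζ(D) is the (real, negative) value of the Riemann zeta function at D ∈ (0,1), so that c_D > 0. -/

import Mathlib

open MeasureTheory Filter Topology Asymptotics

/-- An ordinary fractal string: a bounded open subset `Ω ⊆ ℝ` realized as a
countable disjoint union of (infinitely many) nonempty open intervals, whose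
lengths `l_j = b_j - a_j` are listed in nonincreasing order. -/
structure FractalString where
  a : ℕ → ℝ
  b : ℕ → ℝ
  lt : ∀ j, a j < b j
  disj : Pairwise fun i j => Disjoint (Set.Ioo (a i) (b i)) (Set.Ioo (a j) (b j))
  bdd : Bornology.IsBounded (⋃ j, Set.Ioo (a j) (b j))
  anti : Antitone fun j => b j - a j

namespace FractalString

/-- The lengths `l_j` of the string. -/
def l (S : FractalString) (j : ℕ) : ℝ := S.b j - S.a j

/-- The bounded open set `Ω ⊆ ℝ` of the string. -/
def Omega (S : FractalString) : Set ℝ := ⋃ j, Set.Ioo (S.a j) (S.b j)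

/-- The inner `ε`-neighborhood `Ω_ε = {x ∈ Ω : dist(x, ∂Ω) < ε}` of `∂Ω`. -/
def innerNbhd (S : FractalString) (ε : ℝ) : Set ℝ :=
  {x ∈ S.Omega | Metric.infDist x (frontier S.Omega) < ε}

/-- The dimension of the string: the abscissa of convergence
`D = inf{σ : Σ_j l_j^σ < ∞}` of its geometric zeta function. -/
noncomputable def dimension (S : FractalString) : ℝ :=
  sInf {σ : ℝ | Summable fun j => S.l j ^ σ}

/-- The spectral counting function `N_ν(x) = Σ_j ⌊l_j x⌋`. -/
noncomputable def Nnu (S : FractalString) (x : ℝ) : ℝ :=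
  ∑' j : ℕ, (⌊S.l j * x⌋ : ℝ)

/-- The Weyl term `W(x) = vol₁(Ω)·x = (Σ_j l_j)·x`. -/
noncomputable def weyl (S : FractalString) (x : ℝ) : ℝ :=
  (∑' j : ℕ, S.l j) * x

/-- `vol₁(Ω_ε)/ε^{1-D} → M` as `ε → 0⁺`. -/
def MinkTendsto (S : FractalString) (D M : ℝ) : Prop :=
  Tendsto (fun ε : ℝ => (volume (S.innerNbhd ε)).toReal / ε ^ (1 - D))
    (𝓝[>] 0) (𝓝 M)

/-- The string is Minkowski measurable of dimension `D`: the limit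
`M = lim_{ε→0⁺} vol₁(Ω_ε)/ε^{1-D}` exists in `(0, ∞)`. -/
def MinkowskiMeasurable (S : FractalString) (D : ℝ) : Prop :=
  ∃ M, 0 < M ∧ S.MinkTendsto D M

/-- The geometric counting function `N_L(x) = #{j : l_j ≥ 1/x}`. -/
noncomputable def NL (S : FractalString) (x : ℝ) : ℕ :=
  {j : ℕ | 1 / x ≤ S.l j}.ncard

end FractalString

theorem Complex.hasDerivAt_ofReal_cpow (c : ℂ) {x : ℝ} (hx : 0 < x) :
    HasDerivAt (fun y : ℝ => (y : ℂ) ^ c) (c * (x : ℂ) ^ (c - 1)) x := by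
  have h := ((hasDerivAt_id (x : ℂ)).cpow_const (c := c) (Or.inl (by simpa using hx))).comp_ofReal
  simpa using h

namespace ZetaAsymptotics

/-- The first-order Taylor error of `x ↦ x ^ (1 - s)` on `[n + 1, n + 2]`, based at the right
endpoint. -/
noncomputable def defect (n : ℕ) (s : ℂ) : ℂ :=
  (1 - s) * ((n + 2 : ℝ) : ℂ) ^ (-s) - ((n + 2 : ℝ) : ℂ) ^ (1 - s) + ((n + 1 : ℝ) : ℂ) ^ (1 - s)

theorem differentiable_defect (n : ℕ) : Differentiable ℂ (defect n) := by
  have h1 : ((n + 1 : ℝ) : ℂ) ≠ 0 := by exact_mod_cast (by positivity : (n + 1 : ℝ) ≠ 0)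
  have h2 : ((n + 2 : ℝ) : ℂ) ≠ 0 := by exact_mod_cast (by positivity : (n + 2 : ℝ) ≠ 0)
  intro s
  unfold defect
  have e1 : DifferentiableAt ℂ (fun s : ℂ => ((n + 1 : ℝ) : ℂ) ^ (1 - s)) s :=
    DifferentiableAt.const_cpow (by fun_prop) (Or.inl h1)
  have e2 : DifferentiableAt ℂ (fun s : ℂ => ((n + 2 : ℝ) : ℂ) ^ (1 - s)) s :=
    DifferentiableAt.const_cpow (by fun_prop) (Or.inl h2)
  have e3 : DifferentiableAt ℂ (fun s : ℂ => ((n + 2 : ℝ) : ℂ) ^ (-s)) s :=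
    DifferentiableAt.const_cpow (by fun_prop) (Or.inl h2)
  exact ((((differentiableAt_const _).sub differentiableAt_id).mul e3).sub e2).add e1

theorem norm_defect_le (n : ℕ) {s : ℂ} {δ R : ℝ} (hδ : 0 < δ) (hs : δ ≤ s.re) (hR : ‖s‖ ≤ R) :
    ‖defect n s‖ ≤ R * (1 + R) * (1 / (n + 1 : ℝ) ^ (δ + 1)) := by
  set m : ℝ := n + 1 with hm
  have hm1 : 1 ≤ m := by simp [hm]
  have hR0 : 0 ≤ R := (norm_nonneg s).trans hR
  have h1s : ‖1 - s‖ ≤ 1 + R := (norm_sub_le _ _).trans (by simpa using hR)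
  set C : ℝ := R * (1 + R) * (1 / m ^ (δ + 1)) with hC
  have hC0 : 0 ≤ C := by positivity
  have hd (x : ℝ) (hx : x ∈ Set.Icc m (m + 1)) :
      HasDerivWithinAt (fun y : ℝ => (1 - s) * (y : ℂ) ^ (-s))
        ((1 - s) * (-s * (x : ℂ) ^ (-s - 1))) (Set.Icc m (m + 1)) x :=
    ((Complex.hasDerivAt_ofReal_cpow (-s) (by linarith [hx.1])).const_mul _).hasDerivWithinAt
  have hb (x : ℝ) (hx : x ∈ Set.Icc m (m + 1)) :
      ‖(1 - s) * (-s * (x : ℂ) ^ (-s - 1))‖ ≤ C := by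
    have hx0 : 0 < x := by linarith [hx.1]
    rw [norm_mul, norm_mul, norm_neg, Complex.norm_cpow_eq_rpow_re_of_pos hx0]
    have : x ^ (-s - 1).re ≤ 1 / m ^ (δ + 1) := by
      rw [one_div, ← Real.rpow_neg (by linarith)]
      calc x ^ (-s - 1).re ≤ x ^ (-(δ + 1)) :=
            Real.rpow_le_rpow_of_exponent_le (by linarith [hx.1]) (by simp; linarith)
        _ ≤ m ^ (-(δ + 1)) :=
            Real.rpow_le_rpow_of_nonpos (by linarith) hx.1 (by linarith)
    calc ‖1 - s‖ * (‖s‖ * x ^ (-s - 1).re) ≤ (1 + R) * (R * (1 / m ^ (δ + 1))) := by gcongr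
      _ = C := by rw [hC]; ring
  have hmem : m + 1 ∈ Set.Icc m (m + 1) := by simp
  have hd' (x : ℝ) (hx : x ∈ Set.Icc m (m + 1)) :
      HasDerivWithinAt (fun y : ℝ => (y : ℂ) ^ (1 - s) - y * ((1 - s) * ((m + 1 : ℝ) : ℂ) ^ (-s)))
        ((1 - s) * (x : ℂ) ^ (-s) - (1 - s) * ((m + 1 : ℝ) : ℂ) ^ (-s))
        (Set.Icc m (m + 1)) x := by
    have h := Complex.hasDerivAt_ofReal_cpow (1 - s) (x := x) (by linarith [hx.1])
    rw [show 1 - s - 1 = -s by ring] at h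
    have h2 := (Complex.ofRealCLM.hasDerivAt (x := x)).mul_const
      ((1 - s) * ((m + 1 : ℝ) : ℂ) ^ (-s))
    simpa using (h.fun_sub h2).hasDerivWithinAt
  have hb' (x : ℝ) (hx : x ∈ Set.Icc m (m + 1)) :
      ‖(1 - s) * (x : ℂ) ^ (-s) - (1 - s) * ((m + 1 : ℝ) : ℂ) ^ (-s)‖ ≤ C := by
    refine ((convex_Icc m (m + 1)).norm_image_sub_le_of_norm_hasDerivWithin_le hd hb hmem hx).trans
      (mul_le_of_le_one_right hC0 ?_)
    rw [Real.norm_eq_abs, abs_le]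
    constructor <;> linarith [hx.1, hx.2]
  have h := (convex_Icc m (m + 1)).norm_image_sub_le_of_norm_hasDerivWithin_le hd' hb' hmem
    (show m ∈ Set.Icc m (m + 1) by simp)
  have hn : ‖m - (m + 1)‖ = 1 := by simp
  rw [hn, mul_one] at h
  refine le_of_eq_of_le (congrArg _ ?_) h
  rw [defect, ← hm, show (n + 2 : ℝ) = m + 1 by rw [hm]; ring]
  push_cast
  ring

theorem sum_defect (N : ℕ) (s : ℂ) :
    ∑ n ∈ Finset.range N, defect n s =
      (1 - s) * ∑ n ∈ Finset.range (N + 1), ((n + 1 : ℝ) : ℂ) ^ (-s)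
        - ((N + 1 : ℝ) : ℂ) ^ (1 - s) + s := by
  induction N with
  | zero => simp
  | succ N ih =>
    rw [Finset.sum_range_succ, ih, Finset.sum_range_succ _ (N + 1), defect]
    push_cast
    rw [show (N : ℂ) + 1 + 1 = N + 2 by ring]
    ring

theorem summable_defect_bound {δ : ℝ} (hδ : 0 < δ) (C : ℝ) :
    Summable fun n : ℕ => C * (1 / (n + 1 : ℝ) ^ (δ + 1)) := by
  refine Summable.mul_left _ ?_
  have := (summable_nat_add_iff 1).mpr (Real.summable_one_div_nat_rpow.mpr
    (show 1 < δ + 1 by linarith))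
  simpa using this

theorem tsum_defect_of_one_lt {s : ℂ} (hs : 1 < s.re) :
    ∑' n, defect n s = s - riemannZeta₁ s := by
  have hne : s ≠ 1 := by rintro rfl; simp at hs
  have hsum : Summable fun n => defect n s :=
    .of_norm_bounded (summable_defect_bound (δ := 1) one_pos _)
      fun n => norm_defect_le n one_pos hs.le le_rfl
  refine tendsto_nhds_unique hsum.hasSum.tendsto_sum_nat ?_
  have h1 : Tendsto (fun N : ℕ => ∑ n ∈ Finset.range (N + 1), ((n + 1 : ℝ) : ℂ) ^ (-s)) atTop
      (𝓝 (riemannZeta s)) := by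
    have hz : Summable fun n : ℕ => 1 / ((n : ℂ) + 1) ^ s := by
      have := (summable_nat_add_iff 1).mpr (Complex.summable_one_div_nat_cpow.mpr hs)
      simpa using this
    have := (hz.hasSum.tendsto_sum_nat).comp (tendsto_add_atTop_nat 1)
    rw [← zeta_eq_tsum_one_div_nat_add_one_cpow hs] at this
    refine this.congr fun N => ?_
    simp [Complex.cpow_neg]
  have h2 : Tendsto (fun N : ℕ => ((N + 1 : ℝ) : ℂ) ^ (1 - s)) atTop (𝓝 0) := by
    rw [tendsto_zero_iff_norm_tendsto_zero]
    have h3 : Tendsto (fun N : ℕ => (N + 1 : ℝ) ^ (-(s.re - 1))) atTop (𝓝 0) :=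
      (tendsto_rpow_neg_atTop (by linarith)).comp
        (tendsto_atTop_add_const_right _ _ tendsto_natCast_atTop_atTop)
    refine h3.congr fun N => ?_
    rw [Complex.norm_cpow_eq_rpow_re_of_pos (by positivity)]
    congr 1
    simp
  have h := ((h1.const_mul (1 - s)).sub h2).add_const s
  simp_rw [sum_defect]
  convert h using 2
  rw [riemannZeta_eq_inv_sub_mul hne]
  have : s - 1 ≠ 0 := sub_ne_zero.mpr hne
  field_simp
  ring

theorem hasSum_defect {s : ℂ} (hs : 0 < s.re) :
    HasSum (fun n => defect n s) (s - riemannZeta₁ s) := by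
  set δ := s.re / 2 with hδ
  set R := ‖s‖ + 3 with hR
  have hδ0 : 0 < δ := by positivity
  have hδ1 : δ < s.re := by rw [hδ]; linarith
  set U : Set ℂ := {z | δ < z.re} ∩ Metric.ball 0 R with hU
  have hUo : IsOpen U := (isOpen_lt continuous_const Complex.continuous_re).inter Metric.isOpen_ball
  have hUc : IsPreconnected U :=
    ((convex_halfSpace_re_gt δ).inter (convex_ball 0 R)).isPreconnected
  have hbd (n : ℕ) (z : ℂ) (hz : z ∈ U) :
      ‖defect n z‖ ≤ R * (1 + R) * (1 / (n + 1 : ℝ) ^ (δ + 1)) :=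
    norm_defect_le n hδ0 hz.1.le (mem_ball_zero_iff.mp hz.2).le
  have hsU : s ∈ U := ⟨hδ1, by simp [hR]⟩
  have hδR : s.re ≤ ‖s‖ := Complex.re_le_norm s
  have hz₀ : ((s.re / 2 + 2 : ℝ) : ℂ) ∈ U := by
    refine ⟨by simp [hδ], ?_⟩
    rw [mem_ball_zero_iff, Complex.norm_real, Real.norm_of_nonneg (by linarith)]
    linarith
  have hdiff := Complex.differentiableOn_tsum_of_summable_norm (summable_defect_bound hδ0 _)
    (fun n => (differentiable_defect n).differentiableOn) hUo hbd
  have heq : Set.EqOn (fun z => ∑' n, defect n z) (fun z => z - riemannZeta₁ z) U := by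
    refine (hdiff.analyticOnNhd hUo).eqOn_of_preconnected_of_eventuallyEq
      (Differentiable.differentiableOn (by fun_prop) |>.analyticOnNhd hUo) hUc hz₀ ?_
    filter_upwards [(isOpen_lt continuous_const Complex.continuous_re).mem_nhds
      (show (1 : ℝ) < ((s.re / 2 + 2 : ℝ) : ℂ).re by rw [Complex.ofReal_re]; linarith)] with z hz
    exact tsum_defect_of_one_lt hz
  have hsum : Summable fun n => defect n s :=
    .of_norm_bounded (summable_defect_bound hδ0 _) fun n => hbd n s hsU
  have hval : ∑' n, defect n s = s - riemannZeta₁ s := heq hsU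
  exact hval ▸ hsum.hasSum

end ZetaAsymptotics

/-- For `0 < D < 1`, `ζ(D)` is the limit of the partial sums of `∑ n ^ (-D)` after removal of their
divergent part. -/
theorem tendsto_sum_rpow_sub_riemannZeta {D : ℝ} (h0 : 0 < D) (h1 : D < 1) :
    Tendsto (fun N : ℕ => (N + 1 : ℝ) ^ (1 - D)
        - (1 - D) * ∑ n ∈ Finset.range (N + 1), (n + 1 : ℝ) ^ (-D)) atTop
      (𝓝 ((1 - D) * -(riemannZeta D).re)) := by
  have hs : 0 < (D : ℂ).re := by simpa using h0
  have hne : (D : ℂ) ≠ 1 := by exact_mod_cast h1.ne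
  have h := ((Complex.continuous_re.tendsto _).comp
    (ZetaAsymptotics.hasSum_defect hs).tendsto_sum_nat).const_sub D
  refine (h.congr fun N => ?_).trans_eq ?_
  · have hc (x c : ℝ) (hx : 0 < x) : ((x : ℂ) ^ (c : ℂ)) = ((x ^ c : ℝ) : ℂ) :=
      (Complex.ofReal_cpow hx.le c).symm
    have h2 (n : ℕ) : ((n + 1 : ℝ) : ℂ) ^ (-D : ℂ) = (((n + 1 : ℝ) ^ (-D) : ℝ) : ℂ) := by
      rw [← hc _ _ (by positivity)]; push_cast; rfl
    have h3 : ((N + 1 : ℝ) : ℂ) ^ (1 - D : ℂ) = (((N + 1 : ℝ) ^ (1 - D) : ℝ) : ℂ) := by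
      rw [← hc _ _ (by positivity)]; push_cast; rfl
    simp only [Function.comp_apply, ZetaAsymptotics.sum_defect, h2, h3]
    rw [← Complex.ofReal_sum, ← Complex.ofReal_one, ← Complex.ofReal_sub, ← Complex.ofReal_mul,
      ← Complex.ofReal_sub, ← Complex.ofReal_add, Complex.ofReal_re]
    ring
  · congr 1
    have h4 : riemannZeta₁ D = ((D - 1 : ℝ) : ℂ) * riemannZeta D := by
      rw [riemannZeta_eq_inv_sub_mul hne]
      have : (D : ℂ) - 1 ≠ 0 := sub_ne_zero.mpr hne
      push_cast
      field_simp
    rw [h4, Complex.sub_re, Complex.re_ofReal_mul, Complex.ofReal_re]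
    ring

theorem tendsto_of_tendsto_bounds {α β : Type*} {la : Filter α} {lb : Filter β} [lb.NeBot]
    {g : α → ℝ} {L U : β → α → ℝ} {p q : β → ℝ} {c : ℝ}
    (hL : ∀ᶠ k in lb, Tendsto (L k) la (𝓝 (p k))) (hU : ∀ᶠ k in lb, Tendsto (U k) la (𝓝 (q k)))
    (hLg : ∀ᶠ k in lb, ∀ᶠ x in la, L k x ≤ g x) (hgU : ∀ᶠ k in lb, ∀ᶠ x in la, g x ≤ U k x)
    (hp : Tendsto p lb (𝓝 c)) (hq : Tendsto q lb (𝓝 c)) : Tendsto g la (𝓝 c) := by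
  refine tendsto_order.2 ⟨fun a ha => ?_, fun a ha => ?_⟩
  · obtain ⟨k, hk, hLk, hLgk⟩ := ((hp.eventually_const_lt ha).and (hL.and hLg)).exists
    filter_upwards [hLk.eventually_const_lt hk, hLgk] with x h1 h2 using h1.trans_le h2
  · obtain ⟨k, hk, hUk, hgUk⟩ := ((hq.eventually_lt_const ha).and (hU.and hgU)).exists
    filter_upwards [hUk.eventually_lt_const hk, hgUk] with x h1 h2 using h2.trans_lt h1

namespace FractalString

variable (S : FractalString)

theorem l_pos (j : ℕ) : 0 < S.l j := sub_pos.mpr (S.lt j)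

theorem summable_l : Summable S.l := by
  have hv : volume S.Omega < ⊤ := S.bdd.measure_lt_top
  rw [Omega, measure_iUnion S.disj fun _ => measurableSet_Ioo] at hv
  refine (ENNReal.summable_toReal hv.ne).congr fun j => ?_
  rw [Real.volume_Ioo, ENNReal.toReal_ofReal (sub_pos.mpr (S.lt j)).le, l]

theorem isOpen_Omega : IsOpen S.Omega := isOpen_iUnion fun _ => isOpen_Ioo

theorem Ioo_subset_Omega (j : ℕ) : Set.Ioo (S.a j) (S.b j) ⊆ S.Omega :=
  Set.subset_iUnion (fun j => Set.Ioo (S.a j) (S.b j)) j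

theorem Icc_subset_closure_Omega (j : ℕ) : Set.Icc (S.a j) (S.b j) ⊆ closure S.Omega := by
  rw [← closure_Ioo (S.lt j).ne]
  exact closure_mono (S.Ioo_subset_Omega j)

theorem a_mem_frontier (j : ℕ) : S.a j ∈ frontier S.Omega := by
  have hj := S.lt j
  rw [S.isOpen_Omega.frontier_eq]
  refine ⟨S.Icc_subset_closure_Omega j ⟨le_rfl, hj.le⟩, fun h => ?_⟩
  obtain ⟨i, hi⟩ := Set.mem_iUnion.mp h
  have hij : i ≠ j := by
    rintro rfl
    exact lt_irrefl _ hi.1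
  obtain ⟨y, hy1, hy2⟩ := exists_between (lt_min hj hi.2)
  exact Set.disjoint_left.mp (S.disj hij) ⟨hi.1.trans hy1, hy2.trans_le (min_le_right _ _)⟩
    ⟨hy1, hy2.trans_le (min_le_left _ _)⟩

theorem b_mem_frontier (j : ℕ) : S.b j ∈ frontier S.Omega := by
  have hj := S.lt j
  rw [S.isOpen_Omega.frontier_eq]
  refine ⟨S.Icc_subset_closure_Omega j ⟨hj.le, le_rfl⟩, fun h => ?_⟩
  obtain ⟨i, hi⟩ := Set.mem_iUnion.mp h
  have hij : i ≠ j := by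
    rintro rfl
    exact lt_irrefl _ hi.2
  obtain ⟨y, hy1, hy2⟩ := exists_between (max_lt hj hi.1)
  exact Set.disjoint_left.mp (S.disj hij) ⟨(le_max_right _ _).trans_lt hy1, hy2.trans hi.2⟩
    ⟨(le_max_left _ _).trans_lt hy1, hy2⟩

theorem infDist_frontier_lt_iff {j : ℕ} {x ε : ℝ} (hx : x ∈ Set.Ioo (S.a j) (S.b j)) :
    Metric.infDist x (frontier S.Omega) < ε ↔ x < S.a j + ε ∨ S.b j - ε < x := by
  rw [Metric.infDist_lt_iff ⟨_, S.a_mem_frontier j⟩]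
  constructor
  · rintro ⟨y, hy, hxy⟩
    rw [Real.dist_eq, abs_lt] at hxy
    have hy' : y ∉ Set.Ioo (S.a j) (S.b j) := fun h =>
      (S.isOpen_Omega.frontier_eq ▸ hy).2 (S.Ioo_subset_Omega j h)
    rcases le_or_gt y (S.a j) with h | h
    · left; linarith
    · right
      have : S.b j ≤ y := not_lt.mp fun h2 => hy' ⟨h, h2⟩
      linarith
  · rintro (h | h)
    · exact ⟨_, S.a_mem_frontier j, by rw [Real.dist_eq, abs_lt]; constructor <;> linarith [hx.1]⟩
    · exact ⟨_, S.b_mem_frontier j, by rw [Real.dist_eq, abs_lt]; constructor <;> linarith [hx.2]⟩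

theorem innerNbhd_eq_iUnion (ε : ℝ) :
    S.innerNbhd ε = ⋃ j, Set.Ioo (S.a j) (S.b j) \ Set.Icc (S.a j + ε) (S.b j - ε) := by
  ext x
  simp only [innerNbhd, Omega, Set.mem_ofPred_eq, Set.mem_iUnion, Set.mem_sdiff,
    ← exists_and_right]
  refine exists_congr fun j => and_congr_right fun hx => ?_
  rw [← Omega, S.infDist_frontier_lt_iff hx, Set.mem_Icc, not_and_or, not_le, not_le]

theorem summable_of_le_mul_l {f : ℕ → ℝ} (c : ℝ) (h0 : ∀ j, 0 ≤ f j) (h : ∀ j, f j ≤ c * S.l j) :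
    Summable f :=
  .of_nonneg_of_le h0 h (S.summable_l.mul_left c)

/-- The volume of the inner neighborhood, in terms of the lengths alone. -/
theorem volume_innerNbhd {ε : ℝ} (hε : 0 < ε) :
    (volume (S.innerNbhd ε)).toReal = ∑' j, min (S.l j) (2 * ε) := by
  have h0 (j : ℕ) : 0 ≤ min (S.l j) (2 * ε) := le_min (S.l_pos j).le (by positivity)
  have hvol (j : ℕ) : volume (Set.Ioo (S.a j) (S.b j) \ Set.Icc (S.a j + ε) (S.b j - ε)) =
      ENNReal.ofReal (min (S.l j) (2 * ε)) := by
    rw [measure_sdiff (Set.Icc_subset_Ioo (by linarith) (by linarith))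
      measurableSet_Icc.nullMeasurableSet (by simp), Real.volume_Ioo, Real.volume_Icc, l]
    rcases le_total (S.b j - S.a j) (2 * ε) with h | h
    · rw [min_eq_left h, ENNReal.ofReal_of_nonpos (p := S.b j - ε - (S.a j + ε)) (by linarith),
        tsub_zero]
    · rw [min_eq_right h, ← ENNReal.ofReal_sub _ (by linarith)]
      congr 1
      ring
  rw [innerNbhd_eq_iUnion, measure_iUnion
    (fun i j hij => (S.disj hij).mono Set.sdiff_subset Set.sdiff_subset)
    fun _ => measurableSet_Ioo.diff measurableSet_Icc]
  simp_rw [hvol]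
  rw [← ENNReal.ofReal_tsum_of_nonneg h0
    (S.summable_of_le_mul_l 1 h0 fun j => by simp), ENNReal.toReal_ofReal (tsum_nonneg h0)]

variable {S} {D M : ℝ}

theorem summable_min {x s : ℝ} (hx : 0 < x) (hs : 0 ≤ s) :
    Summable fun j => min (S.l j * x) s :=
  S.summable_of_le_mul_l x (fun j => le_min (mul_pos (S.l_pos j) hx).le hs)
    fun _ => (min_le_left _ _).trans_eq (mul_comm _ _)

theorem summable_ite {x s : ℝ} (hx : 0 < x) (hs : 0 < s) :
    Summable fun j => if s ≤ S.l j * x then (1 : ℝ) else 0 := by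
  refine S.summable_of_le_mul_l (x / s) (fun _ => by split_ifs <;> norm_num) fun j => ?_
  have := S.l_pos j
  split_ifs with h
  · rw [div_mul_eq_mul_div, le_div_iff₀ hs]
    linarith
  · positivity

theorem summable_floor {x : ℝ} (hx : 0 < x) : Summable fun j => (⌊S.l j * x⌋ : ℝ) :=
  S.summable_of_le_mul_l x
    (fun j => by exact_mod_cast Int.floor_nonneg.mpr (mul_pos (S.l_pos j) hx).le)
    fun j => (Int.floor_le _).trans_eq (mul_comm _ _)

theorem summable_fract {x : ℝ} (hx : 0 < x) : Summable fun j => Int.fract (S.l j * x) :=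
  S.summable_of_le_mul_l x (fun j => Int.fract_nonneg _) fun j => by
    have h : (0 : ℝ) ≤ ⌊S.l j * x⌋ := by
      exact_mod_cast Int.floor_nonneg.mpr (mul_pos (S.l_pos j) hx).le
    rw [Int.fract, mul_comm x]
    linarith

theorem Nnu_eq {x : ℝ} (hx : 0 < x) :
    S.Nnu x = S.weyl x - ∑' j, Int.fract (S.l j * x) := by
  rw [Nnu, weyl, ← tsum_mul_right, ← (S.summable_l.mul_right x).tsum_sub (summable_fract hx)]
  exact tsum_congr fun j => (Int.self_sub_fract _).symm

theorem MinkTendsto.tendsto_tsum_min (hmink : S.MinkTendsto D M) {s : ℝ} (hs : 0 < s) :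
    Tendsto (fun x => (∑' j, min (S.l j * x) s) / x ^ D) atTop
      (𝓝 (M * 2 ^ (-(1 - D)) * s ^ (1 - D))) := by
  have hlim : Tendsto (fun x : ℝ => s / (2 * x)) atTop (𝓝[>] 0) := by
    refine tendsto_nhdsWithin_iff.mpr ⟨tendsto_const_nhds.div_atTop
      (tendsto_id.const_mul_atTop two_pos), ?_⟩
    filter_upwards [eventually_gt_atTop 0] with x hx
    exact div_pos hs (by positivity)
  have h := (hmink.comp hlim).mul_const (2 ^ (-(1 - D)) * s ^ (1 - D))
  rw [← mul_assoc] at h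
  refine h.congr' ?_
  filter_upwards [eventually_gt_atTop 0] with x hx
  have hε : 0 < s / (2 * x) := by positivity
  have hsum : ∑' j, min (S.l j * x) s = (∑' j, min (S.l j) (2 * (s / (2 * x)))) * x := by
    rw [← tsum_mul_right]
    refine tsum_congr fun j => ?_
    rw [min_mul_of_nonneg _ _ hx.le]
    congr 1
    field_simp
  rw [Function.comp_apply, volume_innerNbhd _ hε, hsum, Real.div_rpow hs.le (by positivity),
    Real.mul_rpow two_pos.le hx.le, Real.rpow_neg two_pos.le, Real.rpow_sub hx, Real.rpow_one]
  have h1 : (0 : ℝ) < 2 ^ (1 - D) := by positivity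
  have h2 : 0 < s ^ (1 - D) := by positivity
  have h3 : 0 < x ^ D := by positivity
  field_simp

/-- The number of lengths that are at least `s / x` is asymptotic to a multiple of `x ^ D`. -/
theorem MinkTendsto.tendsto_tsum_ite (hmink : S.MinkTendsto D M) {s : ℝ} (hs : 0 < s) :
    Tendsto (fun x => (∑' j, if s ≤ S.l j * x then (1 : ℝ) else 0) / x ^ D) atTop
      (𝓝 (M * 2 ^ (-(1 - D)) * ((1 - D) * s ^ (-D)))) := by
  set A := M * 2 ^ (-(1 - D))
  have hderiv : HasDerivAt (fun t : ℝ => t ^ (1 - D)) ((1 - D) * s ^ (-D)) s := by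
    have := Real.hasDerivAt_rpow_const (x := s) (p := 1 - D) (Or.inl hs.ne')
    rwa [show 1 - D - 1 = -D by ring] at this
  have hslope := (hasDerivAt_iff_tendsto_slope.mp hderiv).const_mul A
  let F (t x : ℝ) : ℝ :=
    ((∑' j, min (S.l j * x) t) / x ^ D - (∑' j, min (S.l j * x) s) / x ^ D) / (t - s)
  have hlim (t : ℝ) (ht : 0 < t) :
      Tendsto (F t) atTop (𝓝 (A * slope (fun t : ℝ => t ^ (1 - D)) s t)) := by
    convert ((hmink.tendsto_tsum_min ht).sub (hmink.tendsto_tsum_min hs)).div_const (t - s) using 2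
    rw [slope_def_field]
    ring
  refine tendsto_of_tendsto_bounds (lb := 𝓝[>] (0 : ℝ))
    (L := fun h => F (s + h)) (U := fun h => F (s - h))
    (p := fun h => A * slope (fun t : ℝ => t ^ (1 - D)) s (s + h))
    (q := fun h => A * slope (fun t : ℝ => t ^ (1 - D)) s (s - h)) ?_ ?_ ?_ ?_ ?_ ?_
  · filter_upwards [self_mem_nhdsWithin] with h (hh : 0 < h)
    exact hlim _ (by positivity)
  · filter_upwards [nhdsWithin_le_nhds (gt_mem_nhds hs)] with h hh
    exact hlim _ (by linarith)
  · filter_upwards [self_mem_nhdsWithin] with h (hh : 0 < h)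
    filter_upwards [eventually_gt_atTop 0] with x hx
    have hxD : 0 < x ^ D := by positivity
    simp only [F]
    rw [add_sub_cancel_left, ← sub_div, div_right_comm]
    gcongr
    rw [← (summable_min hx (by positivity)).tsum_sub (summable_min hx hs.le), ← tsum_div_const]
    refine Summable.tsum_le_tsum (fun j => ?_) (((summable_min hx (by positivity)).sub
      (summable_min hx hs.le)).div_const h) (summable_ite hx hs)
    rw [div_le_iff₀ hh]
    split_ifs with hj
    · rw [min_eq_right hj]
      linarith [min_le_right (S.l j * x) (s + h)]
    · rw [min_eq_left (by linarith), min_eq_left (by linarith)]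
      simp
  · filter_upwards [nhdsWithin_le_nhds (gt_mem_nhds hs), self_mem_nhdsWithin] with h hhs (hh : 0 < h)
    filter_upwards [eventually_gt_atTop 0] with x hx
    have hxD : 0 < x ^ D := by positivity
    simp only [F]
    rw [sub_sub_cancel_left, div_neg, ← neg_div, neg_sub, ← sub_div, div_right_comm]
    gcongr
    rw [← (summable_min hx hs.le).tsum_sub (summable_min hx (by linarith)), ← tsum_div_const]
    refine Summable.tsum_le_tsum (fun j => ?_) (summable_ite hx hs) (((summable_min hx hs.le).sub
      (summable_min hx (by linarith))).div_const h)
    rw [le_div_iff₀ hh]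
    split_ifs with hj
    · rw [min_eq_right hj, min_eq_right (by linarith)]
      linarith
    · rw [zero_mul, sub_nonneg]
      exact min_le_min_left _ (by linarith)
  · refine hslope.comp (tendsto_nhdsWithin_iff.mpr ⟨?_, ?_⟩)
    · exact ((continuous_const.add continuous_id).tendsto' 0 s (by simp)).mono_left
        nhdsWithin_le_nhds
    · filter_upwards [self_mem_nhdsWithin] with h (hh : 0 < h)
      simp [hh.ne']
  · refine hslope.comp (tendsto_nhdsWithin_iff.mpr ⟨?_, ?_⟩)
    · exact ((continuous_const.sub continuous_id).tendsto' 0 s (by simp)).mono_left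
        nhdsWithin_le_nhds
    · filter_upwards [self_mem_nhdsWithin] with h (hh : 0 < h)
      simp [hh.ne']

end FractalString

theorem sum_range_ite_le_eq_min_floor {K : ℕ} {u : ℝ} (hu : 0 ≤ u) :
    ∑ n ∈ Finset.range K, (if (n + 1 : ℝ) ≤ u then (1 : ℝ) else 0) =
      (min K ⌊u⌋₊ : ℕ) := by
  have h (n : ℕ) : (n + 1 : ℝ) ≤ u ↔ n < ⌊u⌋₊ := by
    rw [← Nat.succ_le_iff, Nat.le_floor_iff hu]
    simp
  have hfilter : {n ∈ Finset.range K | n < ⌊u⌋₊} = Finset.range (min K ⌊u⌋₊) := by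
    ext n
    simp
  simp_rw [h]
  rw [Finset.sum_boole, hfilter, Finset.card_range]

theorem fract_eq_min_sub_sum {K : ℕ} {u : ℝ} (hu : 0 ≤ u) (huK : u < K) :
    Int.fract u =
      min u K - ∑ n ∈ Finset.range K, (if (n + 1 : ℝ) ≤ u then (1 : ℝ) else 0) := by
  rw [sum_range_ite_le_eq_min_floor hu, min_eq_left huK.le,
    min_eq_right ((Nat.floor_lt hu).mpr huK).le, Int.fract, natCast_floor_eq_intCast_floor hu]

theorem min_sub_sum_eq_zero {K : ℕ} {u : ℝ} (huK : K ≤ u) :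
    min u K - ∑ n ∈ Finset.range K, (if (n + 1 : ℝ) ≤ u then (1 : ℝ) else 0) = 0 := by
  have hu : 0 ≤ u := K.cast_nonneg.trans huK
  rw [sum_range_ite_le_eq_min_floor hu, min_eq_right huK, min_eq_left (Nat.le_floor huK),
    sub_self]

namespace FractalString

variable {S : FractalString} {D M : ℝ}

theorem MinkTendsto.tendsto_tsum_fract (hD : D ∈ Set.Ioo (0 : ℝ) 1) (hmink : S.MinkTendsto D M) :
    Tendsto (fun x => (∑' j, Int.fract (S.l j * x)) / x ^ D) atTop
      (𝓝 (M * 2 ^ (-(1 - D)) * ((1 - D) * -(riemannZeta D).re))) := by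
  set A := M * 2 ^ (-(1 - D))
  let G (K : ℕ) (x : ℝ) : ℝ := (∑' j, min (S.l j * x) ((K + 1 : ℕ) : ℝ)) / x ^ D
    - ∑ n ∈ Finset.range (K + 1), (∑' j, if (n + 1 : ℝ) ≤ S.l j * x then (1 : ℝ) else 0) / x ^ D
  let I (K : ℕ) (x : ℝ) : ℝ :=
    (∑' j, if ((K + 1 : ℕ) : ℝ) ≤ S.l j * x then (1 : ℝ) else 0) / x ^ D
  let p (K : ℕ) : ℝ := A * ((K + 1 : ℕ) : ℝ) ^ (1 - D)
    - ∑ n ∈ Finset.range (K + 1), A * ((1 - D) * (n + 1 : ℝ) ^ (-D))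
  let q (K : ℕ) : ℝ := A * ((1 - D) * ((K + 1 : ℕ) : ℝ) ^ (-D))
  have hG (K : ℕ) : Tendsto (G K) atTop (𝓝 (p K)) :=
    (hmink.tendsto_tsum_min (by positivity)).sub
      (tendsto_finsetSum _ fun n _ => hmink.tendsto_tsum_ite (by positivity))
  have hI (K : ℕ) : Tendsto (I K) atTop (𝓝 (q K)) := hmink.tendsto_tsum_ite (by positivity)
  have hp : Tendsto p atTop (𝓝 (A * ((1 - D) * -(riemannZeta D).re))) := by
    refine ((tendsto_sum_rpow_sub_riemannZeta hD.1 hD.2).const_mul A).congr fun K => ?_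
    simp only [p, ← Finset.mul_sum]
    push_cast
    ring
  have hq : Tendsto q atTop (𝓝 0) := by
    have : Tendsto (fun K : ℕ => ((K + 1 : ℕ) : ℝ) ^ (-D)) atTop (𝓝 0) :=
      ((tendsto_rpow_neg_atTop hD.1).comp tendsto_natCast_atTop_atTop).comp
        (tendsto_add_atTop_nat 1)
    have h := (this.const_mul (1 - D)).const_mul A
    rwa [mul_zero, mul_zero] at h
  let f (K : ℕ) (u : ℝ) : ℝ := min u ((K + 1 : ℕ) : ℝ)
    - ∑ n ∈ Finset.range (K + 1), (if (n + 1 : ℝ) ≤ u then (1 : ℝ) else 0)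
  have hfs (K : ℕ) {x : ℝ} (hx : 0 < x) : Summable fun j => f K (S.l j * x) :=
    (summable_min hx (by positivity)).sub (summable_sum fun n _ => summable_ite hx (by positivity))
  have hGf (K : ℕ) {x : ℝ} (hx : 0 < x) : G K x = (∑' j, f K (S.l j * x)) / x ^ D := by
    simp only [G, f]
    rw [(summable_min hx (by positivity)).tsum_sub
      (summable_sum fun n _ => summable_ite hx (by positivity)),
      Summable.tsum_finsetSum fun n _ => summable_ite hx (by positivity), sub_div, Finset.sum_div]
  refine tendsto_of_tendsto_bounds (lb := atTop) (L := G) (U := fun K x => G K x + I K x)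
    (.of_forall hG) (.of_forall fun K => (hG K).add (hI K)) (.of_forall fun K => ?_)
    (.of_forall fun K => ?_) hp (by simpa using hp.add hq)
  · filter_upwards [eventually_gt_atTop 0] with x hx
    rw [hGf K hx]
    refine div_le_div_of_nonneg_right
      ((hfs K hx).tsum_le_tsum (fun j => ?_) (summable_fract hx)) (by positivity)
    rcases lt_or_ge (S.l j * x) ((K + 1 : ℕ) : ℝ) with h | h
    · exact (fract_eq_min_sub_sum (mul_pos (S.l_pos j) hx).le h).ge
    · exact (min_sub_sum_eq_zero h).trans_le (Int.fract_nonneg _)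
  · filter_upwards [eventually_gt_atTop 0] with x hx
    have hi := summable_ite (S := S) hx (s := ((K + 1 : ℕ) : ℝ)) (by positivity)
    rw [hGf K hx, ← add_div, ← (hfs K hx).tsum_add hi]
    refine div_le_div_of_nonneg_right
      ((summable_fract hx).tsum_le_tsum (fun j => ?_) ((hfs K hx).add hi)) (by positivity)
    rcases lt_or_ge (S.l j * x) ((K + 1 : ℕ) : ℝ) with h | h
    · rw [if_neg h.not_ge, add_zero]
      exact (fract_eq_min_sub_sum (mul_pos (S.l_pos j) hx).le h).le
    · rw [if_pos h, show f K (S.l j * x) = 0 from min_sub_sum_eq_zero h, zero_add]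
      exact (Int.fract_lt_one _).le

end FractalString

/-- Direct spectral problem (Lapidus–Pomerance): if an ordinary fractal string
is Minkowski measurable of dimension `D ∈ (0,1)` with Minkowski content `M`,
then `N_ν(x) = W(x) - c_D x^D + o(x^D)` as `x → +∞`, where
`c_D = 2^{-(1-D)} (1-D) (-ζ(D)) M > 0`. -/
theorem direct_spectral_problem (D : ℝ) (hD : D ∈ Set.Ioo (0 : ℝ) 1)
    (S : FractalString) (M : ℝ) (hM : 0 < M) (hmink : S.MinkTendsto D M) :
    (fun x : ℝ => S.Nnu x -
        (S.weyl x -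
          ((2 : ℝ) ^ (-(1 - D)) * (1 - D) * (-(riemannZeta D).re) * M) * x ^ D))
      =o[atTop] fun x : ℝ => x ^ D := by
  have hlim := hmink.tendsto_tsum_fract hD
  refine isLittleO_of_tendsto' ?_ ?_
  · filter_upwards [eventually_gt_atTop 0] with x hx h
    exact absurd h (Real.rpow_pos_of_pos hx D).ne'
  · have h := hlim.const_sub (M * 2 ^ (-(1 - D)) * ((1 - D) * -(riemannZeta D).re))
    rw [sub_self] at h
    refine h.congr' ?_
    filter_upwards [eventually_gt_atTop 0] with x hx
    have hxD : 0 < x ^ D := Real.rpow_pos_of_pos hx D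
    rw [FractalString.Nnu_eq hx]
    generalize ∑' j, Int.fract (S.l j * x) = F
    field_simp
    ring
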